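/- A loopless graph G is either the single-vertex graph K_1 or a loopless 3-edge-connected graph if and only if G is either K_1 or loopless 2-edge-connected, and G does not have, as a cc-minor, a cycle with at least two edges. -/

import Mathlib

open scoped Classical

noncomputable section

/-- A finite multigraph with vertices and edge names drawn from `ℕ`.
Each edge name `e ∈ E` has a pair of (possibly equal) endpoints `ends e`. -/
structure MGraph where
  V : Finset ℕ
  E : Finset ℕ
  ends : ℕ → Sym2 ℕ
  ends_mem : ∀ e ∈ E, ∀ v ∈ ends e, v ∈ V

namespace MGraph

/-- Adjacency via some edge. -/
def Adj (G : MGraph) (u v : ℕ) : Prop := ∃ e ∈ G.E, G.ends e = s(u, v)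

/-- Reachability. -/
def Reach (G : MGraph) : ℕ → ℕ → Prop := Relation.ReflTransGen G.Adj

/-- A graph is connected if it has a vertex and all vertices are mutually reachable. -/
def Connected (G : MGraph) : Prop :=
  G.V.Nonempty ∧ ∀ u ∈ G.V, ∀ v ∈ G.V, G.Reach u v

/-- Delete a set of edges. -/
def deleteEdges (G : MGraph) (Z : Finset ℕ) : MGraph where
  V := G.V
  E := G.E \ Z
  ends := G.ends
  ends_mem := fun e he => G.ends_mem e (Finset.mem_sdiff.mp he).1

/-- A graph with at least two vertices is `k`-edge-connected if deleting any
set of fewer than `k` edges leaves it connected. -/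
def EdgeConnected (G : MGraph) (k : ℕ) : Prop :=
  2 ≤ G.V.card ∧ ∀ Z ⊆ G.E, Z.card < k → (G.deleteEdges Z).Connected

/-- A graph is loopless if no edge has equal endpoints. -/
def Loopless (G : MGraph) : Prop := ∀ e ∈ G.E, ¬ (G.ends e).IsDiag

/-- The set of vertices met by an edge set. -/
def vertsOf (G : MGraph) (C : Finset ℕ) : Finset ℕ :=
  G.V.filter (fun v => ∃ e ∈ C, v ∈ G.ends e)

/-- Degree of `v` in the edge set `C` (loops counted twice). -/
def degIn (G : MGraph) (C : Finset ℕ) (v : ℕ) : ℕ :=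
  ∑ e ∈ C, (if G.ends e = s(v, v) then 2 else if v ∈ G.ends e then 1 else 0)

/-- `C` is the edge set of a cycle of `G`: a nonempty connected edge set in which
every vertex met has degree exactly two (a loop and a pair of parallel edges are cycles). -/
def IsCycleSet (G : MGraph) (C : Finset ℕ) : Prop :=
  C.Nonempty ∧ C ⊆ G.E ∧
  (∀ v ∈ G.vertsOf C, G.degIn C v = 2) ∧
  ∀ u ∈ G.vertsOf C, ∀ v ∈ G.vertsOf C,
    Relation.ReflTransGen (fun a b => ∃ e ∈ C, G.ends e = s(a, b)) u v

/-- The vertex map identifying all vertices of `U` (within `G.V`) to a single one. -/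
def cmapOn (G : MGraph) (U : Finset ℕ) : ℕ → ℕ :=
  fun v => if v ∈ U ∩ G.V then sInf {w : ℕ | w ∈ U ∩ G.V} else v

/-- Contract the vertex set `U` to a single vertex, deleting the edges of `S` and all
newly created loops (edges with both ends in `U` that were not already loops), while
keeping pre-existing loops not in `S`. -/
def contractOn (G : MGraph) (U S : Finset ℕ) : MGraph where
  V := G.V.image (G.cmapOn U)
  E := G.E.filter (fun e => ¬ (∀ v ∈ G.ends e, v ∈ U) ∨ ((G.ends e).IsDiag ∧ e ∉ S))
  ends := fun e => (G.ends e).map (G.cmapOn U)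
  ends_mem := by
    intro e he v hv
    have he' : e ∈ G.E := (Finset.mem_filter.mp he).1
    rw [Sym2.mem_map] at hv
    obtain ⟨w, hw, rfl⟩ := hv
    have hwV : w ∈ G.V := G.ends_mem e he' w hw
    by_cases h : w ∈ U ∩ G.V
    · have hmem : sInf {x : ℕ | x ∈ U ∩ G.V} ∈ U ∩ G.V := Nat.sInf_mem ⟨w, h⟩
      refine Finset.mem_image.mpr ⟨sInf {x : ℕ | x ∈ U ∩ G.V},
        (Finset.mem_inter.mp hmem).2, ?_⟩
      simp [cmapOn, h, hmem]
    · exact Finset.mem_image.mpr ⟨w, hwV, by simp [cmapOn, h]⟩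

/-- Contract a cycle (given by its edge set), deleting all created loops. -/
def contractCycle (G : MGraph) (C : Finset ℕ) : MGraph :=
  G.contractOn (G.vertsOf C) C

/-- `H` is a cycle-contraction minor (cc-minor) of `G`: `H` is obtained from `G` by
a sequence of cycle contractions (each accompanied by contraction of created loops). -/
def CCMinor (G H : MGraph) : Prop :=
  Relation.ReflTransGen (fun A B => ∃ C, A.IsCycleSet C ∧ B = A.contractCycle C) G H

/-- Walks: a vertex list together with a matching edge list. -/
inductive IsWalk (G : MGraph) : List ℕ → List ℕ → Prop
  | nil {v : ℕ} (hv : v ∈ G.V) : IsWalk G [v] []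
  | cons {u v : ℕ} {e : ℕ} {vs es : List ℕ} (he : e ∈ G.E)
      (hends : G.ends e = s(u, v)) (hw : IsWalk G (v :: vs) es) :
      IsWalk G (u :: v :: vs) (e :: es)

/-- A path from `u` to `v`, given by its vertex list and edge list. -/
def IsPathBetween (G : MGraph) (u v : ℕ) (vs es : List ℕ) : Prop :=
  G.IsWalk vs es ∧ vs.Nodup ∧ vs.head? = some u ∧ vs.getLast? = some v

/-- `G` is `k`-connected: it has at least `k` vertices and any two distinct vertices are
joined by at least `k` pairwise internally disjoint paths. -/
def KConnected (G : MGraph) (k : ℕ) : Prop :=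
  k ≤ G.V.card ∧ ∀ u ∈ G.V, ∀ v ∈ G.V, u ≠ v →
    ∃ P : Fin k → List ℕ × List ℕ,
      (∀ i, G.IsPathBetween u v (P i).1 (P i).2) ∧
      ∀ i j, i ≠ j →
        (∀ x, x ∈ (P i).1 → x ∈ (P j).1 → x = u ∨ x = v) ∧
        (∀ e, e ∈ (P i).2 → e ∉ (P j).2)

/-- A simple graph: no loops and no parallel edges. -/
def Simple (G : MGraph) : Prop :=
  G.Loopless ∧ ∀ e ∈ G.E, ∀ f ∈ G.E, G.ends e = G.ends f → e = f

/-- Graph isomorphism. -/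
def Iso (G H : MGraph) : Prop :=
  ∃ φ ψ : ℕ → ℕ, Set.BijOn φ ↑G.V ↑H.V ∧ Set.BijOn ψ ↑G.E ↑H.E ∧
    ∀ e ∈ G.E, H.ends (ψ e) = (G.ends e).map φ

/-- The bond graph `B n`: two vertices joined by `n` parallel edges. -/
def IsBondGraph (H : MGraph) (n : ℕ) : Prop :=
  ∃ u v : ℕ, u ≠ v ∧ H.V = {u, v} ∧ H.E.card = n ∧ ∀ e ∈ H.E, H.ends e = s(u, v)

end MGraph

namespace MGraph

/-- `F` is a subgraph of `G`. -/
def IsSubgraph (F G : MGraph) : Prop :=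
  F.V ⊆ G.V ∧ F.E ⊆ G.E ∧ ∀ e ∈ F.E, F.ends e = G.ends e

end MGraph

/-- A graph that is a cycle: its whole edge set is a cycle meeting all its vertices. -/
def MGraph.IsCycleGraph (H : MGraph) : Prop :=
  H.IsCycleSet H.E ∧ H.V = H.vertsOf H.E

namespace MGraph

section Degree

variable {G : MGraph} {F : Finset ℕ}

lemma mem_vertsOf {v : ℕ} : v ∈ G.vertsOf F ↔ v ∈ G.V ∧ ∃ e ∈ F, v ∈ G.ends e := by
  simp [vertsOf]

lemma vertsOf_subset : G.vertsOf F ⊆ G.V := Finset.filter_subset _ _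

lemma mem_vertsOf_of_mem_ends (hF : F ⊆ G.E) {e v : ℕ} (he : e ∈ F) (hv : v ∈ G.ends e) :
    v ∈ G.vertsOf F :=
  mem_vertsOf.2 ⟨G.ends_mem e (hF he) v hv, e, he, hv⟩

lemma vertsOf_mono {F' : Finset ℕ} (h : F ⊆ F') : G.vertsOf F ⊆ G.vertsOf F' := by
  intro v hv
  obtain ⟨hV, e, he, hve⟩ := mem_vertsOf.1 hv
  exact mem_vertsOf.2 ⟨hV, e, h he, hve⟩

lemma Loopless.exists_ends (hG : G.Loopless) {e : ℕ} (he : e ∈ G.E) :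
    ∃ a b, a ≠ b ∧ G.ends e = s(a, b) := by
  obtain ⟨⟨a, b⟩, h⟩ := Quot.exists_rep (G.ends e)
  refine ⟨a, b, fun hab => hG e he ?_, h.symm⟩
  rw [← h]
  exact hab

/-- In a loopless graph the degree counts the incident edges. -/
lemma Loopless.degIn_eq_card (hG : G.Loopless) (hF : F ⊆ G.E) (v : ℕ) :
    G.degIn F v = (F.filter (fun e => v ∈ G.ends e)).card := by
  rw [degIn, Finset.card_filter]
  refine Finset.sum_congr rfl fun e he => ?_
  rw [if_neg]
  intro h
  apply hG e (hF he)
  rw [h]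
  exact rfl

/-- The handshake lemma, for a set of vertices containing all those met by the edges. -/
lemma Loopless.sum_degIn (hG : G.Loopless) (hF : F ⊆ G.E) {W : Finset ℕ}
    (hW : G.vertsOf F ⊆ W) : ∑ v ∈ W, G.degIn F v = 2 * F.card := by
  simp_rw [hG.degIn_eq_card hF, Finset.card_filter]
  rw [Finset.sum_comm, mul_comm, ← smul_eq_mul, ← Finset.sum_const]
  refine Finset.sum_congr rfl fun e he => ?_
  obtain ⟨a, b, hab, h⟩ := hG.exists_ends (hF he)
  rw [← Finset.card_filter]
  have : W.filter (fun v => v ∈ G.ends e) = {a, b} := by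
    ext v
    simp only [Finset.mem_filter, Finset.mem_insert, Finset.mem_singleton, h, Sym2.mem_iff]
    refine ⟨fun hv => hv.2, fun hv => ⟨hW (mem_vertsOf_of_mem_ends hF he ?_), hv⟩⟩
    rw [h]
    exact Sym2.mem_iff.2 hv
  rw [this, Finset.card_pair hab]

/-- If all degrees are at least two and the edges are at most as many as the vertices, then all
degrees equal two. -/
lemma Loopless.degIn_eq_two (hG : G.Loopless) (hF : F ⊆ G.E) {W : Finset ℕ}
    (hW : G.vertsOf F ⊆ W) (hdeg : ∀ v ∈ W, 2 ≤ G.degIn F v) (hcard : F.card ≤ W.card) :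
    ∀ v ∈ W, G.degIn F v = 2 := by
  have hsum := hG.sum_degIn hF hW
  have hle : ∑ v ∈ W, 2 ≤ ∑ v ∈ W, G.degIn F v := Finset.sum_le_sum hdeg
  have heq : ∑ v ∈ W, 2 = ∑ v ∈ W, G.degIn F v := by
    rw [Finset.sum_const, smul_eq_mul] at hle ⊢
    omega
  exact fun v hv => ((Finset.sum_eq_sum_iff_of_le hdeg).1 heq v hv).symm

/-- A nonempty edge set meeting at most as many vertices as it has edges contains a cycle. -/
lemma Loopless.exists_isCycleSet (hG : G.Loopless) (hF : F ⊆ G.E) (hne : F.Nonempty)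
    (hcard : (G.vertsOf F).card ≤ F.card) : ∃ C ⊆ F, G.IsCycleSet C := by
  induction F using Finset.strongInduction with
  | H F ih =>
  by_cases hmin : ∃ F' ⊂ F, F'.Nonempty ∧ (G.vertsOf F').card ≤ F'.card
  · obtain ⟨F', hss, hne', hc⟩ := hmin
    obtain ⟨C, hC, h⟩ := ih F' hss (hss.1.trans hF) hne' hc
    exact ⟨C, hC.trans hss.1, h⟩
  push Not at hmin
  have hcard2 : 2 ≤ F.card := by
    obtain ⟨e, he⟩ := hne
    obtain ⟨a, b, hab, h⟩ := hG.exists_ends (hF he)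
    refine le_trans ?_ hcard
    rw [← Finset.card_pair hab]
    refine Finset.card_le_card fun v hv => mem_vertsOf_of_mem_ends hF he ?_
    rw [h]
    simpa using hv
  have herase : ∀ e ∈ F, F.card ≤ (G.vertsOf (F.erase e)).card := by
    intro e he
    have h1 := Finset.card_erase_of_mem he
    have := hmin _ (Finset.erase_ssubset he) (Finset.card_pos.1 (by omega))
    omega
  have hle : F.card ≤ (G.vertsOf F).card := by
    obtain ⟨e, he⟩ := hne
    exact (herase e he).trans (Finset.card_le_card (vertsOf_mono (Finset.erase_subset _ _)))
  refine ⟨F, subset_rfl, hne, hF, hG.degIn_eq_two hF subset_rfl ?_ hle, ?_⟩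
  · intro v hv
    rw [hG.degIn_eq_card hF]
    obtain ⟨hV, e, he, hve⟩ := mem_vertsOf.1 hv
    by_contra! hlt
    have hsub : G.vertsOf (F.erase e) ⊆ (G.vertsOf F).erase v := by
      intro w hw
      refine Finset.mem_erase.2 ⟨?_, vertsOf_mono (Finset.erase_subset _ _) hw⟩
      rintro rfl
      obtain ⟨-, e', he', hve'⟩ := mem_vertsOf.1 hw
      rw [Finset.mem_erase] at he'
      exact he'.1 (Finset.card_le_one.1 (Nat.lt_succ_iff.1 hlt) e'
        (Finset.mem_filter.2 ⟨he'.2, hve'⟩) e (Finset.mem_filter.2 ⟨he, hve⟩))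
    have h1 := Finset.card_le_card hsub
    rw [Finset.card_erase_of_mem hv] at h1
    have := herase e he
    omega
  · intro u hu v hv
    by_contra hnot
    set R : ℕ → ℕ → Prop := fun a b => ∃ e ∈ F, G.ends e = s(a, b)
    let p : ℕ → Prop := Relation.ReflTransGen R u
    have hstep : ∀ e ∈ F, ∀ a ∈ G.ends e, ∀ b ∈ G.ends e, p a → p b := by
      intro e he a ha b hb hpa
      by_cases hab : a = b
      · exact hab ▸ hpa
      · exact hpa.tail ⟨e, he, (Sym2.mem_and_mem_iff hab).1 ⟨ha, hb⟩⟩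
    set A := F.filter (fun e => ∀ a ∈ G.ends e, p a)
    have hlt : ∀ F' ⊆ F, ∀ w ∈ G.vertsOf F',
        ∀ w' ∈ G.vertsOf F, w' ∉ G.vertsOf F' → F'.card < (G.vertsOf F').card := by
      intro F' hF' w hw w' hw' hn
      refine hmin F' (Finset.ssubset_iff_subset_ne.2 ⟨hF', ?_⟩) ?_
      · rintro rfl
        exact hn hw'
      · obtain ⟨-, e, he, -⟩ := mem_vertsOf.1 hw
        exact ⟨e, he⟩
    have hAp : ∀ w ∈ G.vertsOf A, p w := by
      intro w hw
      obtain ⟨-, e, he, hwe⟩ := mem_vertsOf.1 hw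
      exact (Finset.mem_filter.1 he).2 w hwe
    have hBp : ∀ w ∈ G.vertsOf (F \ A), ¬ p w := by
      intro w hw hpw
      obtain ⟨-, e, he, hwe⟩ := mem_vertsOf.1 hw
      rw [Finset.mem_sdiff] at he
      exact he.2 (Finset.mem_filter.2 ⟨he.1, fun b hb => hstep e he.1 w hwe b hb hpw⟩)
    have hcover : ∀ w ∈ G.vertsOf F, w ∈ G.vertsOf A ∨ w ∈ G.vertsOf (F \ A) := by
      intro w hw
      obtain ⟨hV, e, he, hwe⟩ := mem_vertsOf.1 hw
      by_cases heA : e ∈ A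
      · exact .inl (mem_vertsOf.2 ⟨hV, e, heA, hwe⟩)
      · exact .inr (mem_vertsOf.2 ⟨hV, e, Finset.mem_sdiff.2 ⟨he, heA⟩, hwe⟩)
    have huA : u ∈ G.vertsOf A := (hcover u hu).resolve_right fun h => hBp u h .refl
    have hvB : v ∈ G.vertsOf (F \ A) := (hcover v hv).resolve_left fun h => hnot (hAp v h)
    have hAF : A ⊆ F := Finset.filter_subset _ _
    have h1 := hlt A hAF u huA v hv fun h => hnot (hAp v h)
    have h2 := hlt (F \ A) Finset.sdiff_subset v hvB u hu fun h => hBp u h .refl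
    have hdisj : Disjoint (G.vertsOf A) (G.vertsOf (F \ A)) :=
      Finset.disjoint_left.2 fun w hw hw' => hBp w hw' (hAp w hw)
    have h3 := Finset.card_le_card (Finset.union_subset (vertsOf_mono (G := G) hAF)
      (vertsOf_mono (G := G) (Finset.sdiff_subset (s := F) (t := A))))
    rw [Finset.card_union_of_disjoint hdisj] at h3
    have h4 := Finset.card_sdiff_add_card_eq_card hAF
    omega

end Degree

section Contract

variable {G : MGraph} {C U : Finset ℕ}

lemma cmapOn_of_mem {v w : ℕ} (hv : v ∈ U ∩ G.V) (hw : w ∈ U ∩ G.V) :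
    G.cmapOn U v = G.cmapOn U w := by
  simp only [cmapOn, if_pos hv, if_pos hw]

lemma cmapOn_of_notMem {v : ℕ} (hv : v ∉ U ∩ G.V) : G.cmapOn U v = v := if_neg hv

lemma cmapOn_mem {v : ℕ} (hv : v ∈ U ∩ G.V) : G.cmapOn U v ∈ U ∩ G.V := by
  rw [cmapOn, if_pos hv]
  exact Nat.sInf_mem (s := {w : ℕ | w ∈ U ∩ G.V}) ⟨v, hv⟩

lemma vertsOf_inter : G.vertsOf C ∩ G.V = G.vertsOf C :=
  Finset.inter_eq_left.2 vertsOf_subset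

lemma Loopless.contractCycle (hG : G.Loopless) (C : Finset ℕ) :
    (G.contractCycle C).Loopless := by
  intro e he
  change e ∈ Finset.filter _ _ at he
  obtain ⟨heE, he⟩ := Finset.mem_filter.1 he
  have he := he.resolve_right fun h => hG e heE h.1
  obtain ⟨a, b, hab, h⟩ := hG.exists_ends heE
  change ¬ ((G.ends e).map (G.cmapOn (G.vertsOf C))).IsDiag
  rw [h] at he ⊢
  rw [Sym2.map_mk, Sym2.mk_isDiag_iff]
  simp only [Sym2.ball] at he
  intro hf
  by_cases ha : a ∈ G.vertsOf C ∩ G.V <;> by_cases hb : b ∈ G.vertsOf C ∩ G.V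
  · rw [vertsOf_inter] at ha hb
    exact he ⟨ha, hb⟩
  · have := cmapOn_mem ha
    rw [hf, cmapOn_of_notMem hb] at this
    exact hb this
  · have := cmapOn_mem hb
    rw [← hf, cmapOn_of_notMem ha] at this
    exact ha this
  · rw [cmapOn_of_notMem ha, cmapOn_of_notMem hb] at hf
    exact hab hf

/-- Contracting a cycle preserves edge-connectivity unless a single vertex is left. -/
lemma EdgeConnected.contractCycle {k : ℕ} (hG : G.EdgeConnected k)
    (h2 : 2 ≤ (G.contractCycle C).V.card) : (G.contractCycle C).EdgeConnected k := by
  refine ⟨h2, fun Z hZ hk => ⟨Finset.card_pos.1 (zero_lt_two.trans_le h2), ?_⟩⟩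
  intro u' hu' v' hv'
  obtain ⟨u, hu, rfl⟩ := Finset.mem_image.1 hu'
  obtain ⟨v, hv, rfl⟩ := Finset.mem_image.1 hv'
  have hreach := (hG.2 Z (hZ.trans (Finset.filter_subset _ _)) hk).2 u hu v hv
  refine Relation.ReflTransGen.lift' (G.cmapOn (G.vertsOf C)) ?_ _ _ hreach
  rintro a b ⟨e, he, hab⟩
  obtain ⟨heE, heZ⟩ := Finset.mem_sdiff.1 he
  change G.ends e = s(a, b) at hab
  by_cases heC : e ∈ (G.contractCycle C).E
  · refine .single ⟨e, Finset.mem_sdiff.2 ⟨heC, heZ⟩, ?_⟩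
    change (G.ends e).map _ = _
    rw [hab, Sym2.map_mk]
  · have hU : ∀ x ∈ G.ends e, x ∈ G.vertsOf C := by
      by_contra hx
      exact heC (Finset.mem_filter.2 ⟨heE, .inl hx⟩)
    rw [hab] at hU
    have ha := hU a (Sym2.mem_mk_left a b)
    have hb := hU b (Sym2.mem_mk_right a b)
    rw [← vertsOf_inter] at ha hb
    rw [Function.onFun, cmapOn_of_mem ha hb]

lemma Loopless.card_contractCycle_lt (hG : G.Loopless) (hC : C ⊆ G.E) (hne : C.Nonempty) :
    (G.contractCycle C).V.card < G.V.card := by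
  obtain ⟨e, he⟩ := hne
  obtain ⟨a, b, hab, h⟩ := hG.exists_ends (hC he)
  have ha : a ∈ G.vertsOf C := mem_vertsOf_of_mem_ends hC he (h ▸ Sym2.mem_mk_left a b)
  have hb : b ∈ G.vertsOf C := mem_vertsOf_of_mem_ends hC he (h ▸ Sym2.mem_mk_right a b)
  refine lt_of_le_of_ne Finset.card_image_le fun hcard => hab ?_
  refine Finset.card_image_iff.1 hcard (vertsOf_subset ha) (vertsOf_subset hb) ?_
  rw [← vertsOf_inter] at ha hb
  exact cmapOn_of_mem ha hb

end Contract

section EdgeConnected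

variable {G : MGraph}

lemma EdgeConnected.mono {k l : ℕ} (hG : G.EdgeConnected k) (h : l ≤ k) : G.EdgeConnected l :=
  ⟨hG.1, fun Z hZ hl => hG.2 Z hZ (hl.trans_le h)⟩

lemma EdgeConnected.le_degIn {k : ℕ} (hG : G.EdgeConnected k) (hl : G.Loopless) {v : ℕ}
    (hv : v ∈ G.V) : k ≤ G.degIn G.E v := by
  rw [hl.degIn_eq_card subset_rfl]
  by_contra! hlt
  obtain ⟨w, hw, hwv⟩ := Finset.exists_mem_ne hG.1 v
  have hreach := (hG.2 _ (Finset.filter_subset _ _) hlt).2 v hv w hw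
  obtain h | ⟨x, ⟨e, he, hends⟩, -⟩ := Relation.ReflTransGen.cases_head hreach
  · exact hwv h.symm
  · obtain ⟨heE, heZ⟩ := Finset.mem_sdiff.1 he
    refine heZ (Finset.mem_filter.2 ⟨heE, ?_⟩)
    change G.ends e = _ at hends
    rw [hends]
    exact Sym2.mem_mk_left v x

/-- A cycle-free set of edges inside a nonempty vertex set `W` has fewer than `W.card` members. -/
lemma Loopless.card_lt_of_forall_not_isCycleSet (hG : G.Loopless) {F W : Finset ℕ}
    (hF : F ⊆ G.E) (hW : G.vertsOf F ⊆ W) (hne : W.Nonempty)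
    (hC : ∀ C ⊆ F, ¬ G.IsCycleSet C) : F.card < W.card := by
  obtain rfl | hF0 := F.eq_empty_or_nonempty
  · simpa using hne
  · refine lt_of_lt_of_le ?_ (Finset.card_le_card hW)
    by_contra! h
    obtain ⟨C, hCF, h⟩ := hG.exists_isCycleSet hF hF0 h
    exact hC C hCF h

/-- A loopless `2`-edge-connected graph that is a forest with separated vertices `u` and `v` after
deleting two edges is a cycle. -/
lemma EdgeConnected.isCycleGraph (hG : G.EdgeConnected 2) (hl : G.Loopless) {Z : Finset ℕ}
    (hZ : Z.card ≤ 2) {p : ℕ → Prop} {u v : ℕ} (hu : u ∈ G.V) (hv : v ∈ G.V) (hpu : p u)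
    (hpv : ¬ p v)
    (hp : ∀ e ∈ G.E, e ∉ Z → ∀ a ∈ G.ends e, ∀ b ∈ G.ends e, p a → p b)
    (hC : ∀ C ⊆ G.E \ Z, ¬ G.IsCycleSet C) : G.IsCycleGraph ∧ 2 ≤ G.E.card := by
  have hcard : G.E.card ≤ G.V.card := by
    set A := (G.E \ Z).filter (fun e => ∀ a ∈ G.ends e, p a)
    have hAF : A ⊆ G.E \ Z := Finset.filter_subset _ _
    have h1 : A.card < (G.V.filter p).card := by
      refine hl.card_lt_of_forall_not_isCycleSet (hAF.trans Finset.sdiff_subset) ?_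
        ⟨u, Finset.mem_filter.2 ⟨hu, hpu⟩⟩ fun C h => hC C (h.trans hAF)
      intro w hw
      obtain ⟨hV, e, he, hwe⟩ := mem_vertsOf.1 hw
      exact Finset.mem_filter.2 ⟨hV, (Finset.mem_filter.1 he).2 w hwe⟩
    have h2 : ((G.E \ Z) \ A).card < (G.V.filter (fun w => ¬ p w)).card := by
      refine hl.card_lt_of_forall_not_isCycleSet
        (Finset.sdiff_subset.trans Finset.sdiff_subset) ?_
        ⟨v, Finset.mem_filter.2 ⟨hv, hpv⟩⟩ fun C h => hC C (h.trans Finset.sdiff_subset)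
      intro w hw
      obtain ⟨hV, e, he, hwe⟩ := mem_vertsOf.1 hw
      obtain ⟨heEZ, heA⟩ := Finset.mem_sdiff.1 he
      obtain ⟨heE, heZ⟩ := Finset.mem_sdiff.1 heEZ
      exact Finset.mem_filter.2 ⟨hV, fun hpw =>
        heA (Finset.mem_filter.2 ⟨heEZ, fun b hb => hp e heE heZ w hwe b hb hpw⟩)⟩
    have h3 := Finset.card_sdiff_add_card_eq_card hAF
    have h4 := Finset.card_filter_add_card_filter_not (s := G.V) p
    have h5 := Finset.le_card_sdiff Z G.E
    omega
  have hdeg : ∀ w ∈ G.V, 2 ≤ G.degIn G.E w := fun w hw => hG.le_degIn hl hw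
  have hdeg2 := hl.degIn_eq_two subset_rfl vertsOf_subset hdeg hcard
  have hsum := hl.sum_degIn subset_rfl (vertsOf_subset (G := G) (F := G.E))
  rw [Finset.sum_congr rfl hdeg2, Finset.sum_const, smul_eq_mul] at hsum
  have hV2 := hG.1
  have hE2 : 2 ≤ G.E.card := by omega
  refine ⟨⟨⟨Finset.card_pos.1 (by omega), subset_rfl, fun w hw => hdeg2 w (vertsOf_subset hw),
    fun a ha b hb => ?_⟩, ?_⟩, hE2⟩
  · refine Relation.ReflTransGen.mono ?_ _ _ ((hG.2 ∅ (Finset.empty_subset _) (by simp)).2 a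
      (vertsOf_subset ha) b (vertsOf_subset hb))
    rintro x y ⟨e, he, h⟩
    exact ⟨e, (Finset.mem_sdiff.1 he).1, h⟩
  · refine Finset.Subset.antisymm (fun w hw => ?_) vertsOf_subset
    have h := hdeg w hw
    rw [hl.degIn_eq_card subset_rfl] at h
    obtain ⟨e, he⟩ := Finset.card_pos.1 (zero_lt_two.trans_le h)
    exact mem_vertsOf.2 ⟨hw, e, Finset.mem_filter.1 he⟩

/-- A loopless `2`-edge-connected graph in which two edges separate `u` from `v` has a cycle with
at least two edges as a cc-minor. -/
lemma EdgeConnected.exists_ccMinor_isCycleGraph {n : ℕ} : ∀ {G : MGraph}, G.V.card = n →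
    G.EdgeConnected 2 → G.Loopless → ∀ {Z : Finset ℕ}, Z.card ≤ 2 → ∀ {p : ℕ → Prop} {u v : ℕ},
    u ∈ G.V → v ∈ G.V → p u → ¬ p v →
    (∀ e ∈ G.E, e ∉ Z → ∀ a ∈ G.ends e, ∀ b ∈ G.ends e, p a → p b) →
    ∃ H, G.CCMinor H ∧ H.IsCycleGraph ∧ 2 ≤ H.E.card := by
  induction n using Nat.strong_induction_on with
  | h n ih =>
  intro G hn hG hl Z hZ p u v hu hv hpu hpv hp
  by_cases hC : ∀ C ⊆ G.E \ Z, ¬ G.IsCycleSet C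
  · exact ⟨G, .refl, hG.isCycleGraph hl hZ hu hv hpu hpv hp hC⟩
  push Not at hC
  obtain ⟨C, hCZ, hC⟩ := hC
  have hconst : ∀ a ∈ G.vertsOf C, ∀ b ∈ G.vertsOf C, p a → p b := by
    intro a ha b hb hpa
    induction hC.2.2.2 a ha b hb with
    | refl => exact hpa
    | @tail x y _ hxy hx =>
      obtain ⟨e, he, h⟩ := hxy
      obtain ⟨heE, heZ⟩ := Finset.mem_sdiff.1 (hCZ he)
      have hxe : x ∈ G.ends e := h ▸ Sym2.mem_mk_left x y
      have hye : y ∈ G.ends e := h ▸ Sym2.mem_mk_right x y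
      exact hp e heE heZ x hxe y hye (hx (mem_vertsOf_of_mem_ends hC.2.1 he hxe))
  have hmap : ∀ w, p (G.cmapOn (G.vertsOf C) w) ↔ p w := by
    intro w
    by_cases hw : w ∈ G.vertsOf C ∩ G.V
    · have hw' := cmapOn_mem hw
      rw [vertsOf_inter] at hw hw'
      exact ⟨hconst _ hw' _ hw, hconst _ hw _ hw'⟩
    · rw [cmapOn_of_notMem hw]
  have hu' : G.cmapOn (G.vertsOf C) u ∈ (G.contractCycle C).V := Finset.mem_image_of_mem _ hu
  have hv' : G.cmapOn (G.vertsOf C) v ∈ (G.contractCycle C).V := Finset.mem_image_of_mem _ hv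
  have hpu' := (hmap u).2 hpu
  have hpv' := mt (hmap v).1 hpv
  have h2 : 2 ≤ (G.contractCycle C).V.card :=
    Finset.one_lt_card.2 ⟨_, hu', _, hv', fun h => hpv' (h ▸ hpu')⟩
  obtain ⟨H, hH, hcyc⟩ := ih _ (hn ▸ hl.card_contractCycle_lt hC.2.1 hC.1) rfl
    (hG.contractCycle h2) (hl.contractCycle C) hZ hu' hv' hpu' hpv' (by
      intro e he heZ a' ha' b' hb' hpa
      obtain ⟨a, ha, rfl⟩ := Sym2.mem_map.1 ha'
      obtain ⟨b, hb, rfl⟩ := Sym2.mem_map.1 hb'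
      exact (hmap b).2 (hp e (Finset.mem_filter.1 he).1 heZ a ha b hb ((hmap a).1 hpa)))
  exact ⟨H, .head ⟨C, hC, rfl⟩ hH, hcyc⟩

/-- Loopless graphs that are `k`-edge-connected or have a single vertex are closed under taking
cc-minors. -/
lemma CCMinor.loopless_and_edgeConnected {G H : MGraph} (h : G.CCMinor H) {k : ℕ}
    (hl : G.Loopless) (hG : G.V.card = 1 ∨ G.EdgeConnected k) :
    H.Loopless ∧ (H.V.card = 1 ∨ H.EdgeConnected k) := by
  induction h with
  | refl => exact ⟨hl, hG⟩
  | @tail A B _ hAB ih =>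
    obtain ⟨C, hC, rfl⟩ := hAB
    obtain ⟨hlA, hA⟩ := ih
    refine ⟨hlA.contractCycle C, ?_⟩
    by_cases h2 : 2 ≤ (A.contractCycle C).V.card
    · obtain hA | hA := hA
      · have := hlA.card_contractCycle_lt hC.2.1 hC.1
        omega
      · exact .inr (hA.contractCycle h2)
    · have hne : A.V.Nonempty := by
        obtain ⟨e, he⟩ := hC.1
        obtain ⟨a, b, -, h⟩ := hlA.exists_ends (hC.2.1 he)
        exact ⟨a, A.ends_mem e (hC.2.1 he) a (h ▸ Sym2.mem_mk_left a b)⟩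
      have : 0 < (A.contractCycle C).V.card := Finset.card_pos.2 (hne.image _)
      exact .inl (by omega)

/-- A loopless graph that is a cycle is neither a single vertex nor `3`-edge-connected. -/
lemma IsCycleGraph.not_edgeConnected_three {H : MGraph} (h : H.IsCycleGraph)
    (hl : H.Loopless) : ¬ (H.V.card = 1 ∨ H.EdgeConnected 3) := by
  obtain ⟨e, he⟩ := h.1.1
  obtain ⟨a, b, hab, hends⟩ := hl.exists_ends he
  have haE : a ∈ H.ends e := hends ▸ Sym2.mem_mk_left a b
  have ha := H.ends_mem e he a haE
  have hb := H.ends_mem e he b (hends ▸ Sym2.mem_mk_right a b)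
  rintro (h1 | h3)
  · exact hab (Finset.card_le_one.1 h1.le a ha b hb)
  · have h2 := h.1.2.2.1 a (h.2 ▸ ha)
    have := h3.le_degIn hl ha
    omega

end EdgeConnected

end MGraph

/-- A loopless graph `G` is either `K₁` or 3-edge-connected if and only if `G` is either
`K₁` or 2-edge-connected, and `G` does not have, as a cc-minor, a cycle with at least
two edges. -/
theorem statement_12 (G : MGraph) (hG : G.Loopless) :
    ((G.V.card = 1 ∧ G.E = ∅) ∨ G.EdgeConnected 3) ↔
      (((G.V.card = 1 ∧ G.E = ∅) ∨ G.EdgeConnected 2) ∧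
        ¬ ∃ H, G.CCMinor H ∧ H.IsCycleGraph ∧ 2 ≤ H.E.card) := by
  constructor
  · intro h
    refine ⟨h.imp_right fun h3 => h3.mono (by norm_num), ?_⟩
    rintro ⟨H, hH, hcyc, -⟩
    obtain ⟨hl, h3⟩ := hH.loopless_and_edgeConnected hG (h.imp_left And.left)
    exact hcyc.not_edgeConnected_three hl h3
  · rintro ⟨h | h, hno⟩
    · exact .inl h
    refine .inr ⟨h.1, fun Z hZ hcard =>
      ⟨Finset.card_pos.1 (zero_lt_two.trans_le h.1), ?_⟩⟩
    intro u hu v hv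
    by_contra hnot
    refine hno (h.exists_ccMinor_isCycleGraph rfl hG (Nat.lt_succ_iff.1 hcard)
      (p := (G.deleteEdges Z).Reach u) hu hv .refl hnot ?_)
    intro e he heZ a ha b hb hpa
    by_cases hab : a = b
    · exact hab ▸ hpa
    · exact hpa.tail ⟨e, Finset.mem_sdiff.2 ⟨he, heZ⟩, (Sym2.mem_and_mem_iff hab).1 ⟨ha, hb⟩⟩
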